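/- Let m ≥ 2 and n be positive integers, let 1 ≤ ℓ < k ≤ n be integers, and let 1 ≤ t_1 < t_2 < … < t_ℓ < k be indices. Then Pr[π̄_{t_j} = t_j for all 1 ≤ j ≤ ℓ, and π̄_k = k, and π̄_{k+1} = k] = (mn − ℓ − 2)! · m^ℓ · m·(m−1) / (mn)!, where π̄ is a uniformly random element of S_{m,n}. -/

import Mathlib

open Finset

/-- `DeckSet m n` : words of length `m*n` over alphabet `Fin n` (symbol `i` models card
type `i+1`) in which every symbol occurs exactly `m` times. -/
def DeckSet (m n : ℕ) : Finset (Fin (m * n) → Fin n) :=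
  Finset.univ.filter fun π => ∀ v : Fin n, (Finset.univ.filter fun t => π t = v).card = m

/-- Feedback history: `feedback G π t` is the list of Yes/No bits received after the
first `t` guesses when playing strategy `G` against deck `π`. -/
def feedback {n N : ℕ} (G : List Bool → Fin n) (π : Fin N → Fin n) : ℕ → List Bool
  | 0 => []
  | t + 1 =>
      feedback G π t ++
        [if h : t < N then decide (G (feedback G π t) = π ⟨t, h⟩) else false]

/-- Score of the deterministic Yes/No-feedback strategy `G` against the deck `π`:
the number of positions `t` where the guess `G (feedback G π t)` equals `π t`. -/
def guessScore {n N : ℕ} (G : List Bool → Fin n) (π : Fin N → Fin n) : ℕ :=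
  (Finset.univ.filter fun t : Fin N => G (feedback G π t.1) = π t).card

/-- The words of `DeckSet m n` that agree with `g` on the set of positions `S`. -/
def pinnedDecks (m n : ℕ) (g : Fin (m * n) → Fin n) (S : Finset (Fin (m * n))) :
    Finset (Fin (m * n) → Fin n) :=
  (DeckSet m n).filter fun π => ∀ s ∈ S, π s = g s

theorem comp_perm_mem_DeckSet {m n : ℕ} {π : Fin (m * n) → Fin n} (hπ : π ∈ DeckSet m n)
    (σ : Equiv.Perm (Fin (m * n))) : π ∘ σ ∈ DeckSet m n := by
  simp only [DeckSet, mem_filter, mem_univ, true_and] at hπ ⊢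
  intro v
  exact (card_equiv σ (by simp)).trans (hπ v)

theorem DeckSet_nonempty (m n : ℕ) : (DeckSet m n).Nonempty := by
  refine ⟨fun s => (finProdFinEquiv.symm s).2, ?_⟩
  simp only [DeckSet, mem_filter, mem_univ, true_and]
  intro v
  have h : (univ.filter fun s : Fin (m * n) => (finProdFinEquiv.symm s).2 = v).card =
      (univ.filter fun p : Fin m × Fin n => p.2 = v).card :=
    card_equiv finProdFinEquiv.symm (by simp)
  have h' : (univ.filter fun p : Fin m × Fin n => p.2 = v) =
      (univ : Finset (Fin m)) ×ˢ {v} := by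
    ext ⟨i, j⟩; simp [eq_comm]
  simpa [h'] using h

/-- Among the positions outside `S`, all are equally likely to carry the symbol `v`. -/
theorem card_pinnedDecks_filter_eq {m n : ℕ} (g : Fin (m * n) → Fin n)
    {S : Finset (Fin (m * n))} {a b : Fin (m * n)} (ha : a ∉ S) (hb : b ∉ S) (v : Fin n) :
    ((pinnedDecks m n g S).filter fun π => π b = v).card =
      ((pinnedDecks m n g S).filter fun π => π a = v).card := by
  have key : ∀ x ∉ S, ∀ y ∉ S, ∀ π ∈ (pinnedDecks m n g S).filter (fun π => π x = v),
      π ∘ Equiv.swap x y ∈ (pinnedDecks m n g S).filter (fun π => π y = v) := by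
    intro x hx y hy π hπ
    simp only [pinnedDecks, mem_filter] at hπ ⊢
    refine ⟨⟨comp_perm_mem_DeckSet hπ.1.1 _, fun s hs => ?_⟩, by simpa using hπ.2⟩
    have hsx : s ≠ x := fun h => hx (h ▸ hs)
    have hsy : s ≠ y := fun h => hy (h ▸ hs)
    simpa [Equiv.swap_apply_of_ne_of_ne hsx hsy] using hπ.1.2 s hs
  refine card_bij' (fun π _ => π ∘ Equiv.swap b a) (fun π _ => π ∘ Equiv.swap a b)
    (key b hb a ha) (key a ha b hb) ?_ ?_
  · intro π _
    ext s
    simp [Equiv.swap_comm a b]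
  · intro π _
    ext s
    simp [Equiv.swap_comm a b]

/-- Pinning one further position `a` multiplies the number of words by the proportion of
symbols `g a` among the cards that are still free. -/
theorem card_pinnedDecks_insert {m n : ℕ} (g : Fin (m * n) → Fin n)
    {S : Finset (Fin (m * n))} {a : Fin (m * n)} (ha : a ∉ S) :
    ((m * n - S.card : ℕ) : ℝ) * (pinnedDecks m n g (insert a S)).card =
      ((m : ℝ) - (S.filter fun s => g s = g a).card) * (pinnedDecks m n g S).card := by
  have hins : pinnedDecks m n g (insert a S) =
      (pinnedDecks m n g S).filter fun π => π a = g a := by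
    ext π
    simp only [pinnedDecks, mem_filter, forall_mem_insert]
    tauto
  have hcount := sum_card_bipartiteAbove_eq_sum_card_bipartiteBelow
    (s := Sᶜ) (t := pinnedDecks m n g S) (fun b π => π b = g a)
  simp only [bipartiteAbove, bipartiteBelow] at hcount
  rw [sum_congr rfl fun b hb => card_pinnedDecks_filter_eq g ha (mem_compl.mp hb) (g a),
    sum_const, card_compl, Fintype.card_fin, smul_eq_mul, ← hins] at hcount
  have hfiber : ∀ π ∈ pinnedDecks m n g S,
      ((Sᶜ.filter fun b => π b = g a).card : ℝ) =
        (m : ℝ) - (S.filter fun s => g s = g a).card := by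
    intro π hπ
    simp only [pinnedDecks, DeckSet, mem_filter, mem_univ, true_and] at hπ
    have h : (S.filter fun s => g s = g a) = S.filter fun s => π s = g a :=
      filter_congr fun s hs => by rw [hπ.2 s hs]
    have hsum : (S.filter fun s => π s = g a).card + (Sᶜ.filter fun s => π s = g a).card = m := by
      refine Eq.trans ?_ (hπ.1 (g a))
      rw [← card_union_of_disjoint (disjoint_filter_filter disjoint_compl_right),
        ← filter_union, union_compl]
    rw [h, eq_sub_iff_add_eq', ← Nat.cast_add, hsum]
  have hcount' := congrArg (Nat.cast : ℕ → ℝ) hcount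
  push_cast at hcount'
  rw [hcount', sum_congr rfl hfiber, sum_const, nsmul_eq_mul, mul_comm]

theorem card_pinnedDecks_of_injOn {m n : ℕ} (g : Fin (m * n) → Fin n)
    (S : Finset (Fin (m * n))) (hg : Set.InjOn g S) :
    ((pinnedDecks m n g S).card : ℝ) * (m * n).factorial =
      (m : ℝ) ^ S.card * (m * n - S.card).factorial * (DeckSet m n).card := by
  induction S using Finset.induction_on with
  | empty => simp [pinnedDecks, mul_comm]
  | insert a S ha ih =>
    have ih := ih (hg.mono (by simp))
    have hstep := card_pinnedDecks_insert g ha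
    have hempty : (S.filter fun s => g s = g a) = ∅ := by
      refine filter_eq_empty_iff.mpr fun s hs h => ha ?_
      rwa [← hg (by simp [hs]) (by simp) h]
    have hlt : S.card < m * n := by
      simpa using card_lt_univ_of_notMem ha
    obtain ⟨r, hr⟩ : ∃ r, m * n - S.card = r + 1 := ⟨m * n - S.card - 1, by omega⟩
    have hr' : m * n - (S.card + 1) = r := by omega
    rw [hempty, hr] at hstep
    rw [hr, Nat.factorial_succ] at ih
    rw [card_insert_of_notMem ha, hr']
    have hpos : ((r + 1 : ℕ) : ℝ) ≠ 0 := by positivity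
    apply mul_left_cancel₀ hpos
    push_cast at hstep ih ⊢
    rw [card_empty] at hstep
    push_cast at hstep
    linear_combination ((m * n).factorial : ℝ) * hstep + (m : ℝ) * ih

/-- For `m ≥ 2`, `1 ≤ ℓ`, indices `t 0 < ⋯ < t (ℓ-1) < k₀ < n` (the 0-indexed version
of `1 ≤ t₁ < ⋯ < t_ℓ < k ≤ n` with `k₀ = k - 1`), the probability that a uniform deck
of `S_{m,n}` has symbol `t j` at position `t j` for all `j`, symbol `k₀` at position
`k₀`, and symbol `k₀` again at position `k₀ + 1`, equals
`(mn - ℓ - 2)! · m^ℓ · m(m-1) / (mn)!`. -/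
theorem fixed_points_with_repeat_probability (m n ℓ k₀ : ℕ) (hm : 2 ≤ m) (hn : 0 < n)
    (hℓ1 : 1 ≤ ℓ) (hk : k₀ < n) (t : Fin ℓ → ℕ) (ht : StrictMono t)
    (htk : ∀ j, t j < k₀) :
    (((DeckSet m n).filter fun π =>
        (∀ j : Fin ℓ, ∀ s : Fin (m * n), s.1 = t j → (π s).1 = t j) ∧
        (∀ s : Fin (m * n), s.1 = k₀ → (π s).1 = k₀) ∧
        (∀ s : Fin (m * n), s.1 = k₀ + 1 → (π s).1 = k₀)).card : ℝ) /
        (DeckSet m n).card =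
      ((m * n - ℓ - 2).factorial : ℝ) * (m : ℝ) ^ ℓ * (m : ℝ) * ((m : ℝ) - 1) /
        ((m * n).factorial : ℝ) := by
  have hkn : k₀ + 1 < m * n := by nlinarith
  have htn : ∀ j, t j < m * n := fun j => by have := htk j; omega
  have htinj := ht.injective
  let g : Fin (m * n) → Fin n := fun s => if h : s.1 < k₀ then ⟨s.1, h.trans hk⟩ else ⟨k₀, hk⟩
  let T : Finset (Fin (m * n)) := univ.image fun j => ⟨t j, htn j⟩
  let a : Fin (m * n) := ⟨k₀, by omega⟩
  let b : Fin (m * n) := ⟨k₀ + 1, hkn⟩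
  have hT : ∀ s ∈ T, s.1 < k₀ := by
    intro s hs
    obtain ⟨j, -, rfl⟩ := mem_image.mp hs
    exact htk j
  have haT : a ∉ T := fun h => lt_irrefl _ (hT a h)
  have hbS : b ∉ insert a T := by
    intro h
    rcases mem_insert.mp h with h | h
    · simp [a, b] at h
    · have := hT b h
      simp [b] at this
  have hga : ∀ s : Fin (m * n), k₀ ≤ s.1 → g s = ⟨k₀, hk⟩ := fun s hs => by
    simp [g, hs.not_gt]
  have hgT : ∀ s : Fin (m * n), s.1 < k₀ → (g s).1 = s.1 := fun s hs => by
    simp [g, hs]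
  have hS : ∀ s ∈ insert a T, (g s).1 = s.1 := by
    intro s hs
    rcases mem_insert.mp hs with rfl | hs
    · rw [hga a le_rfl]
    · exact hgT s (hT s hs)
  have hinj : Set.InjOn g (insert a T : Finset _) := by
    intro x hx y hy hxy
    apply Fin.ext
    rw [← hS x hx, ← hS y hy, hxy]
  have hcard : (insert a T).card = ℓ + 1 := by
    rw [card_insert_of_notMem haT, card_image_of_injective, card_univ, Fintype.card_fin]
    intro i j hij
    exact htinj (Fin.mk.inj hij)
  have hfib : ((insert a T).filter fun s => g s = g b) = {a} := by
    ext s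
    simp only [mem_filter, mem_singleton]
    constructor
    · rintro ⟨hs, h⟩
      apply Fin.ext
      rw [← hS s hs, h, hga b (Nat.le_succ k₀)]
    · rintro rfl
      exact ⟨mem_insert_self _ _, by rw [hga a le_rfl, hga b (Nat.le_succ k₀)]⟩
  have hset : ((DeckSet m n).filter fun π =>
        (∀ j : Fin ℓ, ∀ s : Fin (m * n), s.1 = t j → (π s).1 = t j) ∧
        (∀ s : Fin (m * n), s.1 = k₀ → (π s).1 = k₀) ∧
        (∀ s : Fin (m * n), s.1 = k₀ + 1 → (π s).1 = k₀)) =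
      pinnedDecks m n g (insert b (insert a T)) := by
    refine filter_congr fun π _ => ?_
    simp only [forall_mem_insert, Fin.ext_iff, hga a le_rfl, hga b (Nat.le_succ k₀)]
    constructor
    · rintro ⟨h₁, h₂, h₃⟩
      refine ⟨h₃ b rfl, h₂ a rfl, fun s hs => ?_⟩
      rw [hgT s (hT s hs)]
      obtain ⟨j, -, rfl⟩ := mem_image.mp hs
      exact h₁ j _ rfl
    · rintro ⟨h₃, h₂, h₁⟩
      refine ⟨fun j s hs => ?_, fun s hs => ?_, fun s hs => ?_⟩
      · have hsT : s ∈ T := mem_image.mpr ⟨j, mem_univ _, Fin.ext hs.symm⟩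
        rw [h₁ s hsT, hgT s (hT s hsT), hs]
      · rwa [show s = a from Fin.ext hs]
      · rwa [show s = b from Fin.ext hs]
  have hlt : ℓ + 1 < m * n := by
    have := card_lt_univ_of_notMem hbS
    rwa [hcard, Fintype.card_fin] at this
  obtain ⟨r, hr⟩ : ∃ r, m * n - (ℓ + 1) = r + 1 := ⟨m * n - (ℓ + 1) - 1, by omega⟩
  have hr' : m * n - ℓ - 2 = r := by omega
  have hstep := card_pinnedDecks_insert g hbS
  have hbase := card_pinnedDecks_of_injOn g _ hinj
  rw [hcard, hr] at hstep hbase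
  rw [hfib, card_singleton] at hstep
  rw [Nat.factorial_succ] at hbase
  have hD : ((DeckSet m n).card : ℝ) ≠ 0 :=
    Nat.cast_ne_zero.mpr (DeckSet_nonempty m n).card_pos.ne'
  have hN : ((m * n).factorial : ℝ) ≠ 0 := Nat.cast_ne_zero.mpr (Nat.factorial_ne_zero _)
  have hpos : ((r + 1 : ℕ) : ℝ) ≠ 0 := by positivity
  rw [hset, hr', div_eq_div_iff hD hN]
  apply mul_left_cancel₀ hpos
  push_cast at hstep hbase ⊢
  linear_combination ((m * n).factorial : ℝ) * hstep + ((m : ℝ) - 1) * hbase
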